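/- For nonzero linear subspaces U, V, W of ℝⁿ, the inequality ∠_m(U,V) ≤ ∠_M(U,W) + ∠_m(W,V) holds, where ∠_M denotes the maximal angle and ∠_m the minimal angle between subspaces. -/

import Mathlib

open RealInnerProductSpace

/-- Angle in [0, π/2] between the lines spanned by two vectors. -/
noncomputable def lineAngle {E : Type*} [NormedAddCommGroup E] [InnerProductSpace ℝ E]
    (u v : E) : ℝ :=
  Real.arccos (|⟪u, v⟫| / (‖u‖ * ‖v‖))

/-- Maximal angle between two subspaces:
`∠_M(U,V) = max_{u∈U\0} min_{v∈V\0} ∠(u,v)`. -/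
noncomputable def maxAngle {E : Type*} [NormedAddCommGroup E] [InnerProductSpace ℝ E]
    (U V : Submodule ℝ E) : ℝ :=
  sSup ((fun u => sInf (lineAngle u '' {v : E | v ∈ V ∧ v ≠ 0})) ''
    {u : E | u ∈ U ∧ u ≠ 0})

/-- Minimal angle between two subspaces, 0 in the non-transversal case,
computed on the orthogonal complement of the intersection otherwise
(π/2 when the subspaces are complementary). -/
noncomputable def minAngle {E : Type*} [NormedAddCommGroup E] [InnerProductSpace ℝ E]
    (U V : Submodule ℝ E) : ℝ := by
  classical exact
  if U ⊔ V = ⊤ then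
    if U ⊓ (U ⊓ V)ᗮ = ⊥ ∨ V ⊓ (U ⊓ V)ᗮ = ⊥ then Real.pi / 2
    else sInf {θ : ℝ | ∃ u ∈ U ⊓ (U ⊓ V)ᗮ, u ≠ 0 ∧
      ∃ v ∈ V ⊓ (U ⊓ V)ᗮ, v ≠ 0 ∧ θ = lineAngle u v}
  else 0


section helpers
variable {E : Type*} [NormedAddCommGroup E] [InnerProductSpace ℝ E]

lemma lineAngle_nonneg' (u v : E) : 0 ≤ lineAngle u v := Real.arccos_nonneg _

lemma lineAngle_le' (u v : E) : lineAngle u v ≤ Real.pi / 2 := by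
  unfold lineAngle
  rw [Real.arccos_le_pi_div_two]
  positivity

lemma lineAngle_comm' (u v : E) : lineAngle u v = lineAngle v u := by
  unfold lineAngle
  rw [real_inner_comm, mul_comm]

lemma lineAngle_neg_right' (u v : E) : lineAngle u (-v) = lineAngle u v := by
  simp [lineAngle]

lemma lineAngle_le_angle (u v : E) : lineAngle u v ≤ InnerProductGeometry.angle u v := by
  unfold lineAngle InnerProductGeometry.angle
  apply Real.arccos_le_arccos
  gcongr
  exact le_abs_self _

lemma lineAngle_eq_angle (u v : E) (h : 0 ≤ ⟪u, v⟫) :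
    lineAngle u v = InnerProductGeometry.angle u v := by
  unfold lineAngle InnerProductGeometry.angle
  rw [abs_of_nonneg h]

lemma lineAngle_triangle (x y z : E) :
    lineAngle x z ≤ lineAngle x y + lineAngle y z := by
  have key : ∀ x y z : E, 0 ≤ ⟪x, y⟫ → 0 ≤ ⟪y, z⟫ →
      lineAngle x z ≤ lineAngle x y + lineAngle y z := by
    intro x y z h1 h2
    rw [lineAngle_eq_angle x y h1, lineAngle_eq_angle y z h2]
    exact (lineAngle_le_angle x z).trans (InnerProductGeometry.angle_le_angle_add_angle x y z)
  have key2 : ∀ x y z : E, 0 ≤ ⟪x, y⟫ → lineAngle x z ≤ lineAngle x y + lineAngle y z := by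
    intro x y z h1
    rcases le_total 0 ⟪y, z⟫ with h | h
    · exact key x y z h1 h
    · have := key x y (-z) h1 (by rw [inner_neg_right]; linarith)
      simpa only [lineAngle_neg_right'] using this
  rcases le_total 0 ⟪x, y⟫ with h | h
  · exact key2 x y z h
  · have := key2 x (-y) z (by rw [inner_neg_right]; linarith)
    rw [lineAngle_neg_right', lineAngle_comm' (-y), lineAngle_neg_right', lineAngle_comm' z] at this
    exact this

lemma lineAngle_self' (x : E) (hx : x ≠ 0) : lineAngle x x = 0 := by
  rw [lineAngle_eq_angle _ _ real_inner_self_nonneg, InnerProductGeometry.angle_self hx]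

lemma minAngle_bounds (U V : Submodule ℝ E) : minAngle U V ≤ Real.pi / 2 ∧ 0 ≤ minAngle U V := by
  unfold minAngle
  have hp := Real.pi_pos
  split_ifs with h1 h2
  · constructor <;> linarith
  · push Not at h2
    obtain ⟨u, hu, hu0⟩ := Submodule.exists_mem_ne_zero_of_ne_bot h2.1
    obtain ⟨v, hv, hv0⟩ := Submodule.exists_mem_ne_zero_of_ne_bot h2.2
    constructor
    · refine csInf_le_of_le ⟨0, ?_⟩ ⟨u, hu, hu0, v, hv, hv0, rfl⟩ (lineAngle_le' u v)
      rintro _ ⟨u, -, -, v, -, -, rfl⟩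
      exact lineAngle_nonneg' u v
    · apply Real.sInf_nonneg
      rintro _ ⟨u, -, -, v, -, -, rfl⟩
      exact lineAngle_nonneg' u v
  · constructor <;> linarith

lemma le_maxAngle (U W : Submodule ℝ E) (hW : W ≠ ⊥) (u : E) (hu : u ∈ U) (hu0 : u ≠ 0) (t : ℝ)
    (ht : ∀ w ∈ W, w ≠ 0 → t ≤ lineAngle u w) : t ≤ maxAngle U W := by
  obtain ⟨w, hw, hw0⟩ := Submodule.exists_mem_ne_zero_of_ne_bot hW
  unfold maxAngle
  refine le_csSup_of_le ⟨Real.pi / 2, ?_⟩ ⟨u, ⟨hu, hu0⟩, rfl⟩ ?_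
  · rintro _ ⟨x, -, rfl⟩
    refine csInf_le_of_le ⟨0, ?_⟩ ⟨w, ⟨hw, hw0⟩, rfl⟩ (lineAngle_le' x w)
    rintro _ ⟨v, -, rfl⟩
    exact lineAngle_nonneg' _ _
  · refine le_csInf ⟨_, ⟨w, ⟨hw, hw0⟩, rfl⟩⟩ ?_
    rintro _ ⟨v, ⟨hv, hv0⟩, rfl⟩
    exact ht v hv hv0

lemma maxAngle_nonneg' (U W : Submodule ℝ E) (hU : U ≠ ⊥) (hW : W ≠ ⊥) : 0 ≤ maxAngle U W := by
  obtain ⟨u, hu, hu0⟩ := Submodule.exists_mem_ne_zero_of_ne_bot hU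
  exact le_maxAngle U W hW u hu hu0 0 fun w _ _ => lineAngle_nonneg' u w

lemma pi_le_maxAngle (U W : Submodule ℝ E) (hW : W ≠ ⊥) (y : E) (hy : y ∈ U) (hyW : y ∈ Wᗮ)
    (hy0 : y ≠ 0) : Real.pi / 2 ≤ maxAngle U W := by
  refine le_maxAngle U W hW y hy hy0 _ fun w hw _ => ?_
  have : ⟪y, w⟫ = 0 := by
    rw [real_inner_comm]; exact (Submodule.mem_orthogonal W y).1 hyW w hw
  simp [lineAngle, this]

variable [FiniteDimensional ℝ E]

lemma exists_perp (U W : Submodule ℝ E) (hU : U ≠ ⊥) (hU' : U ≠ ⊤) (hW : W ≠ ⊥) (y : E)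
    (hyW : y ∈ Wᗮ) (hy0 : y ≠ 0) : ∃ x ∈ Uᗮ, x ≠ 0 ∧ lineAngle y x ≤ maxAngle U W := by
  obtain ⟨u, hu, x, hx, rfl⟩ := U.exists_add_mem_mem_orthogonal y
  have hux : ⟪u, x⟫ = 0 := (Submodule.mem_orthogonal U x).1 hx u hu
  have hxu : ⟪x, u⟫ = 0 := by rw [real_inner_comm]; exact hux
  by_cases hx0 : x = 0
  · subst hx0
    rw [add_zero] at *
    have : Uᗮ ≠ ⊥ := by rwa [Ne, Submodule.orthogonal_eq_bot_iff]
    obtain ⟨x, hx, hx0⟩ := Submodule.exists_mem_ne_zero_of_ne_bot this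
    exact ⟨x, hx, hx0, (lineAngle_le' _ _).trans (pi_le_maxAngle U W hW u hu hyW hy0)⟩
  refine ⟨x, hx, hx0, ?_⟩
  by_cases hu0 : u = 0
  · subst hu0
    rw [zero_add, lineAngle_self' x hx0]
    exact maxAngle_nonneg' U W hU hW
  refine le_maxAngle U W hW u hu hu0 _ fun w hw hw0 => ?_
  have hyw : ⟪u, w⟫ + ⟪x, w⟫ = 0 := by
    rw [← inner_add_left, real_inner_comm]; exact (Submodule.mem_orthogonal W _).1 hyW w hw
  unfold lineAngle
  apply Real.arccos_le_arccos
  have h1 : ⟪u + x, x⟫ = ‖x‖ ^ 2 := by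
    rw [inner_add_left, hux, real_inner_self_eq_norm_sq, zero_add]
  have hy2 : ‖u + x‖ ^ 2 = ‖u‖ ^ 2 + ‖x‖ ^ 2 := by
    rw [norm_add_sq_real, hux]; ring
  have pu := norm_pos_iff.2 hu0
  have px := norm_pos_iff.2 hx0
  have pw := norm_pos_iff.2 hw0
  have py := norm_pos_iff.2 hy0
  rw [h1, abs_of_nonneg (sq_nonneg ‖x‖), div_le_div_iff₀ (by positivity) (by positivity)]
  -- key: |⟪u,w⟫| ‖u + x‖ ≤ ‖x‖ ‖u‖ ‖w‖
  have h2 : |⟪‖x‖ ^ 2 • u - ‖u‖ ^ 2 • x, w⟫| ≤ ‖‖x‖ ^ 2 • u - ‖u‖ ^ 2 • x‖ * ‖w‖ :=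
    abs_real_inner_le_norm _ _
  have h3 : ⟪‖x‖ ^ 2 • u - ‖u‖ ^ 2 • x, w⟫ = ‖u + x‖ ^ 2 * ⟪u, w⟫ := by
    rw [inner_sub_left, real_inner_smul_left, real_inner_smul_left, hy2]
    linear_combination (-‖u‖ ^ 2) * hyw
  have h4 : ‖‖x‖ ^ 2 • u - ‖u‖ ^ 2 • x‖ = ‖u‖ * ‖x‖ * ‖u + x‖ := by
    rw [← sq_eq_sq₀ (by positivity) (by positivity), norm_sub_sq_real, real_inner_smul_left,
      real_inner_smul_right, hux, norm_smul, norm_smul, mul_pow, mul_pow (‖u‖ * ‖x‖), hy2]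
    simp
    ring
  rw [h3, h4, abs_mul, abs_of_nonneg (sq_nonneg ‖u + x‖)] at h2
  have h5 : ‖u + x‖ * |⟪u, w⟫| ≤ ‖u‖ * ‖x‖ * ‖w‖ := by
    refine le_of_mul_le_mul_left ?_ py
    linarith
  nlinarith [mul_le_mul_of_nonneg_left h5 px.le]

/-- A maximizing (principal) pair of unit vectors. -/
lemma exists_principal (A B : Submodule ℝ E) (hA : A ≠ ⊥) (hB : B ≠ ⊥) :
    ∃ a ∈ A, ∃ b ∈ B, ‖a‖ = 1 ∧ ‖b‖ = 1 ∧
      ∀ a' ∈ A, ∀ b' ∈ B, |⟪a', b'⟫| ≤ ⟪a, b⟫ * (‖a'‖ * ‖b'‖) := by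
  have unit : ∀ C : Submodule ℝ E, C ≠ ⊥ → (Metric.sphere (0 : E) 1 ∩ C).Nonempty := by
    intro C hC
    obtain ⟨c, hc, hc0⟩ := Submodule.exists_mem_ne_zero_of_ne_bot hC
    refine ⟨‖c‖⁻¹ • c, ?_, C.smul_mem _ hc⟩
    simp [norm_smul, hc0]
  have comp : ∀ C : Submodule ℝ E, IsCompact (Metric.sphere (0 : E) 1 ∩ C) := by
    intro C
    have : ProperSpace E := FiniteDimensional.proper ℝ E
    exact (isCompact_sphere _ _).inter_right C.closed_of_finiteDimensional
  obtain ⟨⟨a, b⟩, ⟨⟨ha1, haA⟩, hb1, hbB⟩, hmax⟩ :=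
    ((comp A).prod (comp B)).exists_isMaxOn ((unit A hA).prod (unit B hB))
      (f := fun p : E × E => ⟪p.1, p.2⟫) (by fun_prop)
  simp only [mem_sphere_iff_norm, sub_zero] at ha1 hb1
  have key : ∀ a' ∈ A, ∀ b' ∈ B, ⟪a', b'⟫ ≤ ⟪a, b⟫ * (‖a'‖ * ‖b'‖) := by
    intro a' ha' b' hb'
    by_cases ha0 : a' = 0
    · simp [ha0]
    by_cases hb0 : b' = 0
    · simp [hb0]
    have pa := norm_pos_iff.2 ha0
    have pb := norm_pos_iff.2 hb0
    have := hmax (show ((‖a'‖⁻¹ • a', ‖b'‖⁻¹ • b') : E × E) ∈ _ from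
      ⟨⟨by simp [norm_smul, ha0], A.smul_mem _ ha'⟩, ⟨by simp [norm_smul, hb0], B.smul_mem _ hb'⟩⟩)
    simp only [Set.mem_ofPred_eq, real_inner_smul_left, real_inner_smul_right] at this
    rw [← div_le_iff₀ (by positivity)]
    refine le_trans (le_of_eq ?_) this
    field_simp
  refine ⟨a, haA, b, hbB, ha1, hb1, fun a' ha' b' hb' => abs_le'.2 ⟨key a' ha' b' hb', ?_⟩⟩
  have := key (-a') (A.neg_mem ha') b' hb'
  simpa only [inner_neg_left, norm_neg] using this

lemma principal_perp (A : Submodule ℝ E) (a b : E) (ha : a ∈ A) (ha1 : ‖a‖ = 1) (hb1 : ‖b‖ = 1)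
    (h : ∀ a' ∈ A, |⟪a', b⟫| ≤ ⟪a, b⟫ * ‖a'‖) : b - ⟪a, b⟫ • a ∈ Aᗮ := by
  obtain ⟨p, hp, q, hq, rfl⟩ := A.exists_add_mem_mem_orthogonal b
  have hq' : ∀ x ∈ A, ⟪x, q⟫ = 0 := (Submodule.mem_orthogonal A q).1 hq
  have e1 : ⟪a, p + q⟫ = ⟪a, p⟫ := by rw [inner_add_right, hq' a ha, add_zero]
  have h1 := h p hp
  rw [e1, inner_add_right, hq' p hp, add_zero, real_inner_self_eq_norm_sq,
    abs_of_nonneg (sq_nonneg _)] at h1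
  rw [e1]
  have h0 : 0 ≤ ⟪a, p⟫ := by
    have := (abs_nonneg _).trans (h a ha)
    rwa [ha1, mul_one, e1] at this
  have h2 : ‖p‖ ≤ ⟪a, p⟫ := by
    rcases (norm_nonneg p).eq_or_lt with h | h
    · rw [← h]; exact h0
    · exact le_of_mul_le_mul_right (by linarith) h
  have h3 : ‖p - ⟪a, p⟫ • a‖ ^ 2 ≤ 0 := by
    rw [norm_sub_sq_real, real_inner_smul_right, norm_smul, ha1, mul_one, real_inner_comm a p,
      Real.norm_eq_abs, sq_abs]
    nlinarith [norm_nonneg p]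
  have h4 : p - ⟪a, p⟫ • a = 0 := by
    rw [← norm_eq_zero]
    exact pow_eq_zero_iff (two_ne_zero) |>.1 (le_antisymm h3 (sq_nonneg _))
  rw [add_sub_right_comm, h4, zero_add]
  exact hq

lemma duality (A B : Submodule ℝ E) (hAB : A ⊓ B = ⊥) (a b : E) (ha : a ∈ A) (ha0 : a ≠ 0)
    (hb : b ∈ B) (hb0 : b ≠ 0) :
    ∃ a' ∈ Aᗮ ⊓ (A ⊔ B), ∃ b' ∈ Bᗮ ⊓ (A ⊔ B), a' ≠ 0 ∧ b' ≠ 0 ∧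
      lineAngle a' b' ≤ lineAngle a b := by
  obtain ⟨p, hp, q, hq, hp1, hq1, hmax⟩ := exists_principal A B
    (Submodule.ne_bot_iff _ |>.2 ⟨a, ha, ha0⟩) (Submodule.ne_bot_iff _ |>.2 ⟨b, hb, hb0⟩)
  have hpS : p ∈ A ⊔ B := Submodule.mem_sup_left hp
  have hqS : q ∈ A ⊔ B := Submodule.mem_sup_right hq
  have n1 : q - ⟪p, q⟫ • p ≠ 0 := by
    intro h
    have : q ∈ A ⊓ B := ⟨by rw [sub_eq_zero.1 h]; exact A.smul_mem _ hp, hq⟩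
    rw [hAB, Submodule.mem_bot] at this
    simp [this] at hq1
  have n2 : p - ⟪p, q⟫ • q ≠ 0 := by
    intro h
    have : p ∈ A ⊓ B := ⟨hp, by rw [sub_eq_zero.1 h]; exact B.smul_mem _ hq⟩
    rw [hAB, Submodule.mem_bot] at this
    simp [this] at hp1
  refine ⟨q - ⟪p, q⟫ • p, ⟨?_, sub_mem hqS (Submodule.smul_mem _ _ hpS)⟩,
    p - ⟪p, q⟫ • q, ⟨?_, sub_mem hpS (Submodule.smul_mem _ _ hqS)⟩, n1, n2, ?_⟩
  · apply principal_perp A p q hp hp1 hq1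
    intro a' ha'
    simpa [hq1] using hmax a' ha' q hq
  · rw [real_inner_comm q p]
    apply principal_perp B q p hq hq1 hp1
    intro b' hb'
    rw [real_inner_comm, real_inner_comm p q]
    simpa [hp1] using hmax p hp b' hb'
  · have hc0 : 0 ≤ ⟪p, q⟫ := by
      have := (abs_nonneg _).trans (hmax p hp q hq)
      simpa [hp1, hq1] using this
    have hmab := hmax a ha b hb
    have hqp : ⟪q, p⟫ = ⟪p, q⟫ := real_inner_comm _ _
    generalize hc : ⟪p, q⟫ = c at *
    have e1 : ‖q - c • p‖ ^ 2 = 1 - c ^ 2 := by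
      rw [norm_sub_sq_real, real_inner_smul_right, norm_smul, hp1, hq1, hqp,
        Real.norm_eq_abs, mul_one, sq_abs]; ring
    have e2 : ‖p - c • q‖ ^ 2 = 1 - c ^ 2 := by
      rw [norm_sub_sq_real, real_inner_smul_right, norm_smul, hp1, hq1, hc,
        Real.norm_eq_abs, mul_one, sq_abs]; ring
    have e3 : ‖q - c • p‖ = ‖p - c • q‖ := by
      rw [← sq_eq_sq₀ (norm_nonneg _) (norm_nonneg _), e1, e2]
    have e4 : ⟪q - c • p, p - c • q⟫ = -(c * (1 - c ^ 2)) := by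
      simp only [inner_sub_left, inner_sub_right, real_inner_smul_left, real_inner_smul_right,
        real_inner_self_eq_norm_sq, hp1, hq1, hqp, hc]
      ring
    have pos : 0 < 1 - c ^ 2 := by
      rw [← e1]; have := norm_pos_iff.2 n1; positivity
    unfold lineAngle
    apply Real.arccos_le_arccos
    rw [e3, ← sq, e2, e4, abs_neg, abs_of_nonneg (mul_nonneg hc0 pos.le), mul_div_assoc,
      div_self pos.ne', mul_one]
    have pa := norm_pos_iff.2 ha0
    have pb := norm_pos_iff.2 hb0
    rw [div_le_iff₀ (by positivity)]
    exact hmab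

lemma minAngle_le_perp (U V : Submodule ℝ E) (z y : E) (hz : z ∈ Vᗮ) (hz0 : z ≠ 0)
    (hy : y ∈ Uᗮ) (hy0 : y ≠ 0) : minAngle U V ≤ lineAngle z y := by
  by_cases h : U ⊔ V = ⊤
  · obtain ⟨u, ⟨hu, huS⟩, v, ⟨hv, hvS⟩, hu0, hv0, hle⟩ := duality Uᗮ Vᗮ
      (by rw [Submodule.inf_orthogonal, h, Submodule.top_orthogonal_eq_bot]) y z hy hy0 hz hz0
    rw [Submodule.orthogonal_orthogonal] at hu hv
    have hS : Uᗮ ⊔ Vᗮ ≤ (U ⊓ V)ᗮ :=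
      sup_le (Submodule.orthogonal_le inf_le_left) (Submodule.orthogonal_le inf_le_right)
    have hu' : u ∈ U ⊓ (U ⊓ V)ᗮ := ⟨hu, hS huS⟩
    have hv' : v ∈ V ⊓ (U ⊓ V)ᗮ := ⟨hv, hS hvS⟩
    unfold minAngle
    rw [if_pos h, if_neg]
    · rw [lineAngle_comm' z y]
      refine csInf_le_of_le ⟨0, ?_⟩ ⟨u, hu', hu0, v, hv', hv0, rfl⟩ hle
      rintro _ ⟨u, -, -, v, -, -, rfl⟩
      exact lineAngle_nonneg' u v
    · rintro (h | h)
      · exact hu0 (by rwa [h, Submodule.mem_bot] at hu')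
      · exact hv0 (by rwa [h, Submodule.mem_bot] at hv')
  · unfold minAngle
    rw [if_neg h]
    exact lineAngle_nonneg' _ _

lemma minAngle_main (U V W : Submodule ℝ E)
    (hU : U ≠ ⊥) (hW : W ≠ ⊥) :
    minAngle U V ≤ maxAngle U W + minAngle W V := by
  have hM := maxAngle_nonneg' U W hU hW
  have hm := (minAngle_bounds U V).1
  have key : ∀ z ∈ Vᗮ, z ≠ 0 → ∀ y ∈ Wᗮ, y ≠ 0 →
      minAngle U V ≤ maxAngle U W + lineAngle z y := by
    intro z hz hz0 y hy hy0
    by_cases hT : U = ⊤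
    · have := pi_le_maxAngle U W hW y (by rw [hT]; trivial) hy hy0
      have := lineAngle_nonneg' z y
      linarith
    · obtain ⟨x, hx, hx0, hle⟩ := exists_perp U W hU hT hW y hy hy0
      have h1 := minAngle_le_perp U V z x hz hz0 hx hx0
      have h2 := lineAngle_triangle z y x
      linarith
  by_cases h : W ⊔ V = ⊤
  · by_cases hd : W ⊓ (W ⊓ V)ᗮ = ⊥ ∨ V ⊓ (W ⊓ V)ᗮ = ⊥
    · have : minAngle W V = Real.pi / 2 := by
        unfold minAngle
        rw [if_pos h, if_pos hd]
      linarith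
    · have e : minAngle W V = sInf {θ : ℝ | ∃ u ∈ W ⊓ (W ⊓ V)ᗮ, u ≠ 0 ∧
          ∃ v ∈ V ⊓ (W ⊓ V)ᗮ, v ≠ 0 ∧ θ = lineAngle u v} := by
        unfold minAngle
        rw [if_pos h, if_neg hd]
      push Not at hd
      obtain ⟨u, hu, hu0⟩ := Submodule.exists_mem_ne_zero_of_ne_bot hd.1
      obtain ⟨v, hv, hv0⟩ := Submodule.exists_mem_ne_zero_of_ne_bot hd.2
      rw [e, ← sub_le_iff_le_add']
      refine le_csInf ⟨_, u, hu, hu0, v, hv, hv0, rfl⟩ ?_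
      rintro _ ⟨w, hw, hw0, v, hv, hv0, rfl⟩
      have disj : (W ⊓ (W ⊓ V)ᗮ) ⊓ (V ⊓ (W ⊓ V)ᗮ) = ⊥ := by
        rw [eq_bot_iff, ← Submodule.inf_orthogonal_eq_bot (W ⊓ V)]
        rintro x ⟨⟨h1, h2⟩, h3, -⟩
        exact ⟨⟨h1, h3⟩, h2⟩
      obtain ⟨y, ⟨hy, hyS⟩, z, ⟨hz, hzS⟩, hy0, hz0, hle⟩ := duality _ _ disj w v hw hw0 hv hv0
      have hS : (W ⊓ (W ⊓ V)ᗮ) ⊔ (V ⊓ (W ⊓ V)ᗮ) ≤ (W ⊓ V)ᗮ := sup_le inf_le_right inf_le_right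
      have perp : ∀ C : Submodule ℝ E, W ⊓ V ≤ C → ∀ x ∈ (C ⊓ (W ⊓ V)ᗮ)ᗮ, x ∈ (W ⊓ V)ᗮ →
          x ∈ Cᗮ := by
        intro C hC x hx hx2
        rw [Submodule.mem_orthogonal] at hx hx2 ⊢
        intro c hc
        obtain ⟨p, hp, q, hq, rfl⟩ := (W ⊓ V).exists_add_mem_mem_orthogonal c
        rw [inner_add_left, hx2 p hp, hx q ⟨?_, hq⟩, add_zero]
        have := C.sub_mem hc (hC hp)
        rwa [add_sub_cancel_left] at this
      have := key z (perp V inf_le_right z hz (hS hzS)) hz0 y (perp W inf_le_left y hy (hS hyS)) hy0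
      rw [lineAngle_comm' z y] at this
      linarith
  · have e : minAngle W V = 0 := by
      unfold minAngle
      rw [if_neg h]
    have : (W ⊔ V)ᗮ ≠ ⊥ := by rwa [Ne, Submodule.orthogonal_eq_bot_iff]
    obtain ⟨z, hz, hz0⟩ := Submodule.exists_mem_ne_zero_of_ne_bot this
    have := key z (Submodule.orthogonal_le le_sup_right hz) hz0 z
      (Submodule.orthogonal_le le_sup_left hz) hz0
    rw [lineAngle_self' z hz0] at this
    rw [e]
    exact this

end helpers

theorem stmt_9 (n : ℕ) (U V W : Submodule ℝ (EuclideanSpace ℝ (Fin n)))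
    (hU : U ≠ ⊥) (hV : V ≠ ⊥) (hW : W ≠ ⊥) :
    minAngle U V ≤ maxAngle U W + minAngle W V := by
  exact minAngle_main U V W hU hW
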